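/- arXiv:1803.01757 — 2 statements merged into one kernel-verified Lean document; each statement's English description precedes it below -/
import Mathlib

section
/- In the exact-data case δ = 0 there holds liminf_{k→∞} ( k² ln(k) ‖F(x_k⁰) − y‖² ) = 0 and liminf_{k→∞} ( k ln(k) ‖x_{k+1}⁰ − x_k⁰‖² ) = 0. -/
open Metric Filter
open scoped RealInnerProductSpace Topology

section Gradient

variable {X : Type*} [NormedAddCommGroup X] [InnerProductSpace ℝ X] [CompleteSpace X]
  {S : Set X} {f : X → ℝ} {g : X → X}

theorem HasGradientAt.hasDerivAt_comp_line {v u d : X} {s : ℝ}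
    (h : HasGradientAt f v (u + s • d)) :
    HasDerivAt (fun r : ℝ => f (u + r • d)) ⟪v, d⟫ s := by
  have hline : HasDerivAt (fun r : ℝ => u + r • d) d s := by
    simpa using ((hasDerivAt_id s).smul_const d).const_add u
  simpa [Function.comp_def] using! h.hasFDerivAt.comp_hasDerivAt s hline

/-- A convex function lies above its tangent planes. -/
theorem ConvexOn.add_inner_le (hf : ConvexOn ℝ S f) {u v w : X} (hu : u ∈ S) (hv : v ∈ S)
    (hg : HasGradientAt f w u) : f u + ⟪w, v - u⟫ ≤ f v := by
  have hφ : ConvexOn ℝ (Set.Icc (0 : ℝ) 1) (fun r : ℝ => f (u + r • (v - u))) := by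
    have h := (hf.comp_affineMap (AffineMap.lineMap (k := ℝ) u v)).subset
      (s := Set.Icc (0 : ℝ) 1) ?_ (convex_Icc 0 1)
    · refine h.congr fun r _ => ?_
      simp [AffineMap.lineMap_apply, add_comm]
    · intro r hr
      simpa [AffineMap.lineMap_apply, add_comm] using hf.1.add_smul_sub_mem hu hv hr
  have hd : HasDerivAt (fun r : ℝ => f (u + r • (v - u))) ⟪w, v - u⟫ 0 :=
    HasGradientAt.hasDerivAt_comp_line (by simpa using hg)
  have := hφ.le_slope_of_hasDerivAt (x := 0) (y := 1) (by simp) (by simp) one_pos hd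
  simp [slope_def_field] at this
  linarith

/-- The descent lemma: a function with `L`-Lipschitz gradient on a convex set is bounded above by
its quadratic model. -/
theorem Convex.le_add_inner_add_sq_of_lipschitz_gradient (hS : Convex ℝ S)
    (hg : ∀ u ∈ S, HasGradientAt f (g u) u) {L : ℝ}
    (hLip : ∀ u ∈ S, ∀ v ∈ S, ‖g u - g v‖ ≤ L * ‖u - v‖) {u v : X} (hu : u ∈ S) (hv : v ∈ S) :
    f v ≤ f u + ⟪g u, v - u⟫ + L / 2 * ‖v - u‖ ^ 2 := by
  set d := v - u with hd
  have hmem : ∀ s ∈ Set.Icc (0 : ℝ) 1, u + s • d ∈ S := fun s hs => hS.add_smul_sub_mem hu hv hs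
  have hder : ∀ s ∈ Set.Icc (0 : ℝ) 1,
      HasDerivAt (fun r : ℝ => f (u + r • d) - r * ⟪g u, d⟫ - L / 2 * ‖d‖ ^ 2 * r ^ 2)
        (⟪g (u + s • d), d⟫ - ⟪g u, d⟫ - L * ‖d‖ ^ 2 * s) s := by
    intro s hs
    convert! ((hg _ (hmem s hs)).hasDerivAt_comp_line.sub
      ((hasDerivAt_id s).mul_const ⟪g u, d⟫)).sub
      ((hasDerivAt_pow 2 s).const_mul (L / 2 * ‖d‖ ^ 2)) using 1
    simp
    ring
  have hanti := antitoneOn_of_deriv_nonpos (convex_Icc (0 : ℝ) 1)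
    (fun s hs => (hder s hs).continuousAt.continuousWithinAt)
    (fun s hs => (hder s (interior_subset hs)).differentiableAt.differentiableWithinAt)
    (fun s hs => by
      have hs := interior_subset hs
      rw [(hder s hs).deriv, ← inner_sub_left]
      have h1 := real_inner_le_norm (g (u + s • d) - g u) d
      have h2 := hLip _ (hmem s hs) u hu
      rw [add_sub_cancel_left, norm_smul, Real.norm_of_nonneg hs.1] at h2
      nlinarith [mul_le_mul_of_nonneg_right h2 (norm_nonneg d)])
  have := hanti (Set.left_mem_Icc.2 zero_le_one) (Set.right_mem_Icc.2 zero_le_one) zero_le_one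
  simp [hd] at this
  simp only [hd]
  linarith

end Gradient

theorem Convex.inner_sub_le_zero_of_forall_norm_le {X : Type*} [NormedAddCommGroup X]
    [InnerProductSpace ℝ X] {K : Set X} (hK : Convex ℝ K) {u p : X} (hp : p ∈ K)
    (h : ∀ v ∈ K, ‖u - p‖ ≤ ‖u - v‖) {v : X} (hv : v ∈ K) : ⟪u - p, v - p⟫ ≤ 0 := by
  refine (norm_eq_iInf_iff_real_inner_le_zero hK hp).1 ?_ v hv
  have : Nonempty K := ⟨⟨p, hp⟩⟩
  refine le_antisymm (le_ciInf fun w => h w w.2) (ciInf_le ⟨0, ?_⟩ (⟨p, hp⟩ : K))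
  rintro _ ⟨w, rfl⟩
  exact norm_nonneg _

theorem Real.not_summable_inv_nat_mul_log : ¬ Summable fun n : ℕ => ((n : ℝ) * Real.log n)⁻¹ := by
  rw [← summable_condensed_iff_of_eventually_nonneg]
  · intro h
    refine Real.not_summable_natCast_inv ((h.mul_left (Real.log 2)).congr fun n => ?_)
    have : Real.log 2 ≠ 0 := (Real.log_pos one_lt_two).ne'
    rcases eq_or_ne (n : ℝ) 0 with hn | hn
    · simp [hn]
    · push_cast
      rw [Real.log_pow]
      field_simp
  · exact Eventually.of_forall fun n => inv_nonneg.2 (by positivity)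
  · filter_upwards [eventually_ge_atTop 2] with n hn
    have h0 : (2 : ℝ) ≤ n := by exact_mod_cast hn
    have h1 : 0 < Real.log n := Real.log_pos (by linarith)
    push_cast
    gcongr
    · linarith
    · linarith

theorem liminf_eq_zero_of_summable_mul {a : ℕ → ℝ} (ha : ∀ n, 0 ≤ a n)
    (h : Summable fun n : ℕ => (n : ℝ) * a n) :
    liminf (fun n : ℕ => (n : ℝ) ^ 2 * Real.log n * a n) atTop = 0 := by
  have hnn : ∀ n : ℕ, 0 ≤ (n : ℝ) ^ 2 * Real.log n * a n := fun n =>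
    mul_nonneg (mul_nonneg (by positivity) (Real.log_natCast_nonneg n)) (ha n)
  have hfreq : ∀ ε > 0, ∃ᶠ n : ℕ in atTop, (n : ℝ) ^ 2 * Real.log n * a n ≤ ε := by
    intro ε hε hev
    refine Real.not_summable_inv_nat_mul_log
      (Summable.of_norm_bounded_eventually_nat (h.mul_left ε⁻¹) ?_)
    filter_upwards [hev, eventually_ge_atTop 2] with n hn h2
    have h0 : (2 : ℝ) ≤ n := by exact_mod_cast h2
    have h1 : 0 < Real.log n := Real.log_pos (by linarith)
    rw [Real.norm_of_nonneg (by positivity), inv_eq_one_div, div_le_iff₀ (by positivity),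
      inv_mul_eq_div, div_mul_eq_mul_div, le_div_iff₀ hε]
    nlinarith [not_le.1 hn]
  have hbdd : IsBoundedUnder (· ≥ ·) atTop fun n : ℕ => (n : ℝ) ^ 2 * Real.log n * a n :=
    isBoundedUnder_of ⟨0, hnn⟩
  refine le_antisymm (le_of_forall_pos_le_add fun ε hε => ?_) ?_
  · simpa using liminf_le_of_frequently_le (hfreq ε hε) hbdd
  · exact le_liminf_of_le (IsCobounded.of_frequently_le (hfreq 1 one_pos))
      (Eventually.of_forall hnn)

theorem tendsto_mul_log_mul_zero {a : ℕ → ℝ} {C : ℝ} (ha : ∀ n, 0 ≤ a n)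
    (h : ∀ n : ℕ, (n : ℝ) ^ 2 * a n ≤ C) :
    Tendsto (fun n : ℕ => (n : ℝ) * Real.log n * a n) atTop (𝓝 0) := by
  have hlog : Tendsto (fun n : ℕ => C * (Real.log n / n)) atTop (𝓝 0) := by
    simpa using ((Real.isLittleO_log_id_atTop.tendsto_div_nhds_zero).comp
      tendsto_natCast_atTop_atTop).const_mul C
  refine squeeze_zero' (Eventually.of_forall fun n => mul_nonneg
    (mul_nonneg n.cast_nonneg (Real.log_natCast_nonneg n)) (ha n)) ?_ hlog
  filter_upwards [eventually_gt_atTop 0] with n hn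
  have hn : (0 : ℝ) < n := by exact_mod_cast hn
  rw [← mul_div_assoc, le_div_iff₀ hn]
  nlinarith [mul_le_mul_of_nonneg_right (h n) (Real.log_natCast_nonneg n)]

theorem hasGradientAt_half_norm_sub_sq {X Y : Type*} [NormedAddCommGroup X]
    [InnerProductSpace ℝ X] [CompleteSpace X] [NormedAddCommGroup Y] [InnerProductSpace ℝ Y]
    [CompleteSpace Y] {F : X → Y} {F' : X →L[ℝ] Y} {u : X} (hF : HasFDerivAt F F' u) (y : Y) :
    HasGradientAt (fun v => (1 / 2) * ‖F v - y‖ ^ 2)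
      (ContinuousLinearMap.adjoint F' (F u - y)) u := by
  rw [hasGradientAt_iff_hasFDerivAt]
  convert! ((hF.sub_const y).norm_sq).const_mul (1 / 2 : ℝ) using 1
  ext v
  simp [ContinuousLinearMap.adjoint_inner_left]

section ProjectedGradient

variable {X : Type*} [NormedAddCommGroup X] [InnerProductSpace ℝ X]

/-- The basic inequality for one step of the projected gradient method. -/
theorem ConvexOn.projected_gradient_step [CompleteSpace X] {S K : Set X} {f : X → ℝ} {g : X → X}
    {L ω : ℝ} (hf : ConvexOn ℝ S f) (hg : ∀ u ∈ S, HasGradientAt f (g u) u)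
    (hLip : ∀ u ∈ S, ∀ v ∈ S, ‖g u - g v‖ ≤ L * ‖u - v‖) (hK : Convex ℝ K) (hKS : K ⊆ S)
    (hω : 0 ≤ ω) (hωL : ω * L ≤ 1) {z p v : X} (hz : z ∈ S) (hp : p ∈ K)
    (hproj : ∀ v ∈ K, ‖z - ω • g z - p‖ ≤ ‖z - ω • g z - v‖) (hv : v ∈ K) :
    2 * ω * f p + ‖z - p‖ ^ 2 ≤ 2 * ω * f v + 2 * ⟪z - p, z - v⟫ := by
  have hdescent := hf.1.le_add_inner_add_sq_of_lipschitz_gradient hg hLip hz (hKS hp)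
  have hconv := hf.add_inner_le hz (hKS hv) (hg z hz)
  have hvar := hK.inner_sub_le_zero_of_forall_norm_le hp hproj hv
  have hexp : ⟪z - ω • g z - p, v - p⟫ =
      ‖z - p‖ ^ 2 - ⟪z - p, z - v⟫ - ω * (⟪g z, z - p⟫ - ⟪g z, z - v⟫) := by
    rw [← real_inner_self_eq_norm_sq, ← inner_sub_right, ← inner_sub_right,
      ← real_inner_smul_left, ← inner_sub_left]
    congr 1 <;> abel
  rw [hexp] at hvar
  rw [← neg_sub z p, inner_neg_right, norm_neg] at hdescent
  rw [← neg_sub z v, inner_neg_right] at hconv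
  have h : ω * f p ≤ ω * (f v + ⟪g z, z - v⟫ - ⟪g z, z - p⟫ + L / 2 * ‖z - p‖ ^ 2) :=
    mul_le_mul_of_nonneg_left (by linarith) hω
  nlinarith [mul_le_mul_of_nonneg_right hωL (sq_nonneg ‖z - p‖)]

theorem accelerated_energy_step {z p x s : X} {ω t a b : ℝ} (ht : 1 ≤ t)
    (hx : 2 * ω * b + ‖z - p‖ ^ 2 ≤ 2 * ω * a + 2 * ⟪z - p, z - x⟫)
    (hs : 2 * ω * b + ‖z - p‖ ^ 2 ≤ 2 * ⟪z - p, z - s⟫) :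
    2 * ω * t ^ 2 * b + ‖x + t • (p - x) - s‖ ^ 2 ≤
      2 * ω * (t * (t - 1)) * a + ‖t • z - (t - 1) • x - s‖ ^ 2 := by
  have hA : t • z - (t - 1) • x - s = (t - 1) • (z - x) + (z - s) := by module
  have hB : x + t • (p - x) - s = (t • z - (t - 1) • x - s) - t • (z - p) := by module
  have hinner : ⟪t • z - (t - 1) • x - s, z - p⟫ =
      (t - 1) * ⟪z - p, z - x⟫ + ⟪z - p, z - s⟫ := by
    rw [hA, inner_add_left, real_inner_smul_left, real_inner_comm, real_inner_comm (z - p)]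
  rw [hB, norm_sub_sq_real, real_inner_smul_right, hinner, norm_smul, mul_pow, Real.norm_eq_abs,
    sq_abs]
  have h0 : 0 ≤ t := by linarith
  nlinarith [mul_le_mul_of_nonneg_left hx (mul_nonneg h0 (sub_nonneg.2 ht)),
    mul_le_mul_of_nonneg_left hs h0]

/-- Convergence rates of the Nesterov scheme with damping parameter `α > 3`, deduced from the
one-step inequalities of the projected gradient method. -/
theorem nesterov_summable_and_bounded {x z : ℕ → X} {s : X} {w : ℕ → ℝ} {ω α D : ℝ} (hω : 0 < ω)
    (hα : 3 < α) (hw : ∀ k, 0 ≤ w k) (hD : ∀ k, ‖x k - s‖ ≤ D)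
    (hz : ∀ k : ℕ, z k = x k + (((k : ℝ) - 1) / ((k : ℝ) + α - 1)) • (x k - x (k - 1)))
    (hx : ∀ k, 2 * ω * w (k + 1) + ‖z k - x (k + 1)‖ ^ 2 ≤
      2 * ω * w k + 2 * ⟪z k - x (k + 1), z k - x k⟫)
    (hs : ∀ k, 2 * ω * w (k + 1) + ‖z k - x (k + 1)‖ ^ 2 ≤ 2 * ⟪z k - x (k + 1), z k - s⟫) :
    (Summable fun k : ℕ => (k : ℝ) * w k) ∧
      ∃ C, ∀ k : ℕ, (k : ℝ) ^ 2 * ‖x (k + 1) - x k‖ ^ 2 ≤ C := by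
  have hα1 : 0 < α - 1 := by linarith
  set t : ℕ → ℝ := fun k => (k + α - 2) / (α - 1) with ht
  have htk : ∀ k : ℕ, (k : ℝ) ≤ (α - 1) * t k := fun k => by
    simp only [ht]
    rw [mul_div_cancel₀ _ hα1.ne']
    linarith
  have ht0 : ∀ k, 0 ≤ t k := fun k =>
    nonneg_of_mul_nonneg_right (k.cast_nonneg.trans (htk k)) hα1
  have hts : ∀ k, t (k + 1) = t k + (α - 1)⁻¹ := fun k => by
    simp only [ht]
    push_cast
    field_simp
    ring
  have ht1 : ∀ k, 1 ≤ t (k + 1) := fun k => by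
    simp only [ht]
    rw [le_div_iff₀ hα1]
    push_cast
    linarith [k.cast_nonneg (α := ℝ)]
  set u : ℕ → X := fun k => x (k - 1) + t k • (x k - x (k - 1)) - s with hu
  set E : ℕ → ℝ := fun k => 2 * ω * t k ^ 2 * w k + ‖u k‖ ^ 2 with hE
  have hE0 : ∀ k, 0 ≤ E k := fun k => by have := hw k; positivity
  set c : ℝ := 1 - 2 * (α - 1)⁻¹ with hc
  have hinv : (α - 1)⁻¹ < 1 / 2 := by
    rw [inv_lt_comm₀ hα1 (by norm_num)]
    norm_num
    linarith
  have hinv0 : 0 < (α - 1)⁻¹ := inv_pos.2 hα1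
  have hc0 : 0 < c := by linarith
  have hstep : ∀ k, E (k + 1) + 2 * ω * c * (t k * w k) ≤ E k := by
    intro k
    have h := accelerated_energy_step (ht1 k) (hx k) (hs k)
    have hu' : t (k + 1) • z k - (t (k + 1) - 1) • x k - s = u k := by
      have hcoef : t (k + 1) * (((k : ℝ) - 1) / ((k : ℝ) + α - 1)) = t k - 1 := by
        have : (k : ℝ) + α - 1 ≠ 0 := by
          have := k.cast_nonneg (α := ℝ)
          linarith
        simp only [ht]
        push_cast
        field_simp
        ring
      rw [hz, smul_add, smul_smul, hcoef]
      simp only [hu]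
      module
    rw [hu'] at h
    have hcoef : t (k + 1) * (t (k + 1) - 1) + c * t k ≤ t k ^ 2 := by
      rw [hts, hc]
      nlinarith
    have := mul_le_mul_of_nonneg_left (mul_le_mul_of_nonneg_right hcoef (hw k)) hω.le
    simp only [hE, hu, Nat.add_sub_cancel] at h ⊢
    linarith
  have hsum : ∀ n, E n + 2 * ω * c * ∑ k ∈ Finset.range n, t k * w k ≤ E 0 := by
    intro n
    induction n with
    | zero => simp
    | succ n ih =>
      rw [Finset.sum_range_succ]
      linarith [hstep n]
  have hωc : 0 < 2 * ω * c := by positivity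
  constructor
  · have htw : Summable fun k => t k * w k := by
      refine summable_of_sum_range_le (c := E 0 / (2 * ω * c))
        (fun k => mul_nonneg (ht0 k) (hw k)) fun n => ?_
      rw [le_div_iff₀ hωc]
      linarith [hsum n, hE0 n]
    refine (htw.mul_left (α - 1)).of_nonneg_of_le (fun k => mul_nonneg k.cast_nonneg (hw k))
      fun k => ?_
    rw [← mul_assoc]
    exact mul_le_mul_of_nonneg_right (htk k) (hw k)
  · refine ⟨((α - 1) * (√(E 0) + D)) ^ 2, fun k => ?_⟩
    have huE : ‖u (k + 1)‖ ≤ √(E 0) := by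
      refine Real.le_sqrt_of_sq_le ?_
      have h1 := hsum (k + 1)
      have h2 : 0 ≤ 2 * ω * c * ∑ k ∈ Finset.range (k + 1), t k * w k :=
        mul_nonneg hωc.le (Finset.sum_nonneg fun k _ => mul_nonneg (ht0 k) (hw k))
      have h3 : 0 ≤ 2 * ω * t (k + 1) ^ 2 * w (k + 1) := by have := hw (k + 1); positivity
      simp only [hE] at h1 ⊢
      linarith
    have hdiff : t (k + 1) * ‖x (k + 1) - x k‖ ≤ √(E 0) + D := by
      have heq : t (k + 1) • (x (k + 1) - x k) = u (k + 1) - (x k - s) := by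
        simp only [hu, Nat.add_sub_cancel]
        abel
      rw [← Real.norm_of_nonneg (ht0 (k + 1)), ← norm_smul, heq]
      exact (norm_sub_le _ _).trans (add_le_add huE (hD k))
    have hk : (k : ℝ) ≤ (α - 1) * t (k + 1) := by
      have := htk (k + 1)
      push_cast at this
      linarith
    rw [← mul_pow]
    refine pow_le_pow_left₀ (by positivity) ?_ 2
    calc (k : ℝ) * ‖x (k + 1) - x k‖ ≤ (α - 1) * t (k + 1) * ‖x (k + 1) - x k‖ := by gcongr
      _ = (α - 1) * (t (k + 1) * ‖x (k + 1) - x k‖) := by ring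
      _ ≤ _ := by gcongr

end ProjectedGradient

/-- In the exact-data case,
`liminf_{k→∞} k² ln(k) ‖F(x_k⁰) − y‖² = 0` and `liminf_{k→∞} k ln(k) ‖x_{k+1}⁰ − x_k⁰‖² = 0`. -/
theorem nesterov_exact_liminf
    {X Y : Type*} [NormedAddCommGroup X] [InnerProductSpace ℝ X] [CompleteSpace X]
    [NormedAddCommGroup Y] [InnerProductSpace ℝ Y] [CompleteSpace Y]
    (x₀ : X) (ρ : ℝ) (hρ : 0 < ρ)
    (F : X → Y) (F' : X → X →L[ℝ] Y)
    (hF : ∀ u ∈ closedBall x₀ (6 * ρ), HasFDerivAt F (F' u) u)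
    (ωb : ℝ) (hωb : ∀ u ∈ closedBall x₀ (6 * ρ), ‖F' u‖ ≤ ωb)
    (y : Y) (xstar : X) (hxstar : xstar ∈ closedBall x₀ ρ) (hFxstar : F xstar = y)
    (Φ0 : X → ℝ)
    (hΦ0 : ∀ u, Φ0 u = (1 / 2) * ‖F u - y‖ ^ 2)
    (hconv : ConvexOn ℝ (closedBall x₀ (6 * ρ)) Φ0)
    (L : ℝ) (hL : 0 < L)
    (hLip : ∀ u ∈ closedBall x₀ (6 * ρ), ∀ v ∈ closedBall x₀ (6 * ρ),
      ‖(ContinuousLinearMap.adjoint (F' u)) (F u - y) -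
        (ContinuousLinearMap.adjoint (F' v)) (F v - y)‖ ≤ L * ‖u - v‖)
    (α ω : ℝ) (hα : 3 < α) (hω : 0 < ω) (hωL : ω < 1 / L)
    (P : X → X)
    (hP_mem : ∀ u, P u ∈ closedBall x₀ (2 * ρ))
    (hP_proj : ∀ u, ∀ v ∈ closedBall x₀ (2 * ρ), ‖u - P u‖ ≤ ‖u - v‖)
    (x z : ℕ → X)
    (hx0 : x 0 = x₀)
    (hz : ∀ k : ℕ, z k = x k + (((k : ℝ) - 1) / ((k : ℝ) + α - 1)) • (x k - x (k - 1)))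
    (hx : ∀ k : ℕ, x (k + 1) = P (z k + ω • (ContinuousLinearMap.adjoint (F' (z k))) (y - F (z k)))) :
    Filter.liminf (fun k : ℕ => (k : ℝ) ^ 2 * Real.log k * ‖F (x k) - y‖ ^ 2) atTop = 0 ∧
    Filter.liminf (fun k : ℕ => (k : ℝ) * Real.log k * ‖x (k + 1) - x k‖ ^ 2) atTop = 0 := by
  have hΦ : Φ0 = fun u => (1 / 2) * ‖F u - y‖ ^ 2 := funext hΦ0
  have hgrad : ∀ u ∈ closedBall x₀ (6 * ρ),
      HasGradientAt Φ0 (ContinuousLinearMap.adjoint (F' u) (F u - y)) u := fun u hu =>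
    hΦ ▸ hasGradientAt_half_norm_sub_sq (hF u hu) y
  have hsub : closedBall x₀ (2 * ρ) ⊆ closedBall x₀ (6 * ρ) :=
    closedBall_subset_closedBall (by linarith)
  have hstar : xstar ∈ closedBall x₀ (2 * ρ) := closedBall_subset_closedBall (by linarith) hxstar
  have hxmem : ∀ k, x k ∈ closedBall x₀ (2 * ρ) := by
    rintro (_ | k)
    · rw [hx0]
      exact mem_closedBall_self (by linarith)
    · exact hx k ▸ hP_mem _
  have hzmem : ∀ k, z k ∈ closedBall x₀ (6 * ρ) := by
    intro k
    rcases Nat.eq_zero_or_pos k with rfl | hk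
    · rw [hz]
      simpa using hsub (hxmem 0)
    · have hk1 : (1 : ℝ) ≤ k := by exact_mod_cast hk
      have hβ0 : 0 ≤ ((k : ℝ) - 1) / ((k : ℝ) + α - 1) := div_nonneg (by linarith) (by linarith)
      have hβ1 : ((k : ℝ) - 1) / ((k : ℝ) + α - 1) ≤ 1 :=
        (div_le_one (by linarith)).2 (by linarith)
      have h1 := hxmem k
      have h2 := hxmem (k - 1)
      rw [mem_closedBall_iff_norm] at h1 h2 ⊢
      have h3 : ‖x k - x (k - 1)‖ ≤ 4 * ρ := by
        rw [← sub_sub_sub_cancel_right _ _ x₀]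
        linarith [norm_sub_le (x k - x₀) (x (k - 1) - x₀)]
      rw [hz, add_sub_right_comm]
      refine (norm_add_le _ _).trans ?_
      rw [norm_smul, Real.norm_of_nonneg hβ0]
      nlinarith [mul_le_mul hβ1 h3 (norm_nonneg _) zero_le_one]
  have hstep : ∀ k, ∀ v ∈ closedBall x₀ (2 * ρ),
      2 * ω * Φ0 (x (k + 1)) + ‖z k - x (k + 1)‖ ^ 2 ≤
        2 * ω * Φ0 v + 2 * ⟪z k - x (k + 1), z k - v⟫ := by
    intro k v hv
    refine hconv.projected_gradient_step hgrad hLip (convex_closedBall _ _) hsub hω.le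
      ((lt_div_iff₀ hL).1 hωL).le (hzmem k) (hxmem (k + 1)) (fun v hv => ?_) hv
    have harg : z k - ω • ContinuousLinearMap.adjoint (F' (z k)) (F (z k) - y) =
        z k + ω • ContinuousLinearMap.adjoint (F' (z k)) (y - F (z k)) := by
      rw [← neg_sub y, map_neg, smul_neg, sub_neg_eq_add]
    rw [harg, hx k]
    exact hP_proj _ v hv
  have hΦstar : Φ0 xstar = 0 := by simp [hΦ0, hFxstar]
  obtain ⟨hsum, C, hC⟩ := nesterov_summable_and_bounded (w := fun k => Φ0 (x k)) (s := xstar)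
    (D := 2 * ρ + ρ) hω hα (fun k => by rw [hΦ0]; positivity)
    (fun k => by
      rw [← dist_eq_norm]
      exact (dist_triangle_right _ _ x₀).trans (add_le_add (hxmem k) hxstar))
    hz (fun k => hstep k (x k) (hxmem k))
    (fun k => by simpa [hΦstar] using hstep k xstar hstar)
  refine ⟨liminf_eq_zero_of_summable_mul (fun k => sq_nonneg _) ?_,
    (tendsto_mul_log_mul_zero (fun k => sq_nonneg _) hC).liminf_eq⟩
  refine (hsum.mul_left 2).congr fun k => ?_
  rw [hΦ0]
  ring
end

section
/- Let τ > 1 and, for each δ > 0 and data y^δ with ‖y − y^δ‖ ≤ δ, let k*(δ, y^δ) be the smallest integer k ≥ 1 with ‖F(x_k^δ) − y^δ‖² ≤ (2(k+α−1)²/(k(α−3)))Δ(δ) + τ²δ². Let S := { x ∈ B_{2ρ}(x₀) : F(x) = y }. Then for every sequence δ_n > 0 with δ_n → 0 and data y_n with ‖y − y_n‖ ≤ δ_n, there exist x̃ ∈ S and a subsequence of the stopped iterates (x_{k*(δ_n, y_n)}^{δ_n}) that converges weakly to x̃. If moreover S is a singleton {x̃}, then the whole sequence (x_{k*(δ_n,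 y_n)}^{δ_n}) converges weakly to x̃. -/
open Metric Filter
open scoped RealInnerProductSpace Topology

section Hilbert

variable {X : Type*} [NormedAddCommGroup X] [InnerProductSpace ℝ X]

/-- A bounded sequence in a real Hilbert space has a weakly convergent subsequence. -/
theorem exists_subseq_tendsto_inner [CompleteSpace X] {u : ℕ → X} {R : ℝ}
    (hu : ∀ n, ‖u n‖ ≤ R) :
    ∃ a : X, ∃ φ : ℕ → ℕ, StrictMono φ ∧
      ∀ h : X, Tendsto (fun m => ⟪u (φ m), h⟫) atTop (𝓝 ⟪a, h⟫) := by
  let M : Submodule ℝ X := (Submodule.span ℝ (Set.range u)).topologicalClosure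
  have huM : ∀ n, u n ∈ M := fun n =>
    Submodule.le_topologicalClosure _ (Submodule.subset_span ⟨n, rfl⟩)
  have hsep : TopologicalSpace.IsSeparable (M : Set X) := by
    rw [Submodule.topologicalClosure_coe]
    exact (Set.countable_range u).isSeparable.span.closure
  have : TopologicalSpace.SeparableSpace M := hsep.separableSpace
  have : CompleteSpace M :=
    (Submodule.isClosed_topologicalClosure _).completeSpace_coe
  let v : ℕ → WeakDual ℝ M := fun n =>
    StrongDual.toWeakDual (InnerProductSpace.toDual ℝ M ⟨u n, huM n⟩)
  have hv : ∀ n, v n ∈ WeakDual.toStrongDual ⁻¹' closedBall (0 : StrongDual ℝ M) R := by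
    intro n
    change InnerProductSpace.toDual ℝ M ⟨u n, huM n⟩ ∈ closedBall 0 R
    rw [mem_closedBall_zero_iff, LinearIsometryEquiv.norm_map]
    exact hu n
  obtain ⟨ψ, -, φ, hφ, hlim⟩ := WeakDual.isSeqCompact_closedBall ℝ M 0 R hv
  let a : M := (InnerProductSpace.toDual ℝ M).symm (WeakDual.toStrongDual ψ)
  refine ⟨a, φ, hφ, fun h => ?_⟩
  have key : ∀ w : M, ⟪(w : X), h⟫ = ⟪w, M.orthogonalProjectionOnto h⟫ := fun w => by
    simp
  rw [key]
  have h1 :=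
    ((WeakDual.eval_continuous (𝕜 := ℝ) (M.orthogonalProjectionOnto h)).tendsto ψ).comp hlim
  have h2 : ⟪a, M.orthogonalProjectionOnto h⟫ = ψ (M.orthogonalProjectionOnto h) := by
    simp only [a, InnerProductSpace.toDual_symm_apply]
    rfl
  rw [h2]
  refine h1.congr fun n => ?_
  rw [key ⟨u (φ n), huM _⟩]
  rfl

/-- The gradient inequality for convex functions. -/
theorem ConvexOn.add_fderiv_sub_le {s : Set X} {f : X → ℝ} (hf : ConvexOn ℝ s f) {a b : X}
    (ha : a ∈ s) (hb : b ∈ s) {f' : X →L[ℝ] ℝ} (hf' : HasFDerivAt f f' a) :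
    f a + f' (b - a) ≤ f b := by
  have hd : HasDerivAt (fun t : ℝ => f (AffineMap.lineMap a b t)) (f' (b - a)) 0 := by
    have h1 : HasDerivAt (fun t : ℝ => AffineMap.lineMap a b t) (b - a) (0 : ℝ) :=
      AffineMap.hasDerivAt_lineMap
    exact HasFDerivAt.comp_hasDerivAt (0 : ℝ) (by simpa using hf') h1
  have hc : ConvexOn ℝ (AffineMap.lineMap a b ⁻¹' s) (f ∘ (AffineMap.lineMap a b : ℝ →ᵃ[ℝ] X)) :=
    hf.comp_affineMap _
  have := hc.le_slope_of_hasDerivAt (x := 0) (y := 1) (by simpa) (by simpa) one_pos hd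
  simp [slope] at this
  rw [map_sub]
  linarith

/-- The descent lemma for functions with Lipschitz gradient on a convex set. -/
theorem Convex.le_add_inner_add_of_gradient_lipschitz {s : Set X} (hs : Convex ℝ s)
    {f : X → ℝ} {g : X → X} {L : ℝ} (hf : ∀ a ∈ s, HasFDerivAt f (innerSL ℝ (g a)) a)
    (hg : ∀ a ∈ s, ∀ b ∈ s, ‖g a - g b‖ ≤ L * ‖a - b‖) {a b : X} (ha : a ∈ s) (hb : b ∈ s) :
    f b ≤ f a + ⟪g a, b - a⟫ + L / 2 * ‖b - a‖ ^ 2 := by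
  have hmem : ∀ t ∈ Set.Icc (0 : ℝ) 1, AffineMap.lineMap a b t ∈ s := fun t ht =>
    hs.lineMap_mem ha hb ht
  let F : ℝ → ℝ := fun t =>
    f (AffineMap.lineMap a b t) - t * ⟪g a, b - a⟫ - L / 2 * ‖b - a‖ ^ 2 * t ^ 2
  let F' : ℝ → ℝ := fun t =>
    ⟪g (AffineMap.lineMap a b t), b - a⟫ - ⟪g a, b - a⟫ - L * ‖b - a‖ ^ 2 * t
  have hd : ∀ t ∈ Set.Icc (0 : ℝ) 1, HasDerivAt F (F' t) t := by
    intro t ht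
    have h1 : HasDerivAt (fun t : ℝ => AffineMap.lineMap a b t) (b - a) t :=
      AffineMap.hasDerivAt_lineMap
    have h2 := (hf _ (hmem t ht)).comp_hasDerivAt t h1
    have h3 := (h2.sub ((hasDerivAt_id t).mul_const ⟪g a, b - a⟫)).sub
      ((hasDerivAt_pow 2 t).const_mul (L / 2 * ‖b - a‖ ^ 2))
    refine HasDerivAt.congr_deriv h3 ?_
    simp [F']
    ring
  have hanti : AntitoneOn F (Set.Icc 0 1) := by
    refine antitoneOn_of_hasDerivWithinAt_nonpos (f' := F') (convex_Icc 0 1)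
      (fun t ht => (hd t ht).continuousAt.continuousWithinAt) ?_ ?_
    · exact fun t ht => (hd t (interior_subset ht)).hasDerivWithinAt
    · intro t ht
      have ht' := interior_subset ht
      have h1 : ⟪g (AffineMap.lineMap a b t) - g a, b - a⟫ ≤ L * ‖b - a‖ ^ 2 * t := by
        calc _ ≤ ‖g (AffineMap.lineMap a b t) - g a‖ * ‖b - a‖ := real_inner_le_norm _ _
          _ ≤ (L * ‖AffineMap.lineMap a b t - a‖) * ‖b - a‖ := by
              gcongr
              exact hg _ (hmem t ht') _ ha
          _ = L * ‖b - a‖ ^ 2 * t := by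
              rw [AffineMap.lineMap_apply_module', add_sub_cancel_right, norm_smul,
                Real.norm_of_nonneg ht'.1]
              ring
      rw [inner_sub_left] at h1
      simp only [F']
      linarith
  have := hanti (Set.left_mem_Icc.2 zero_le_one) (Set.right_mem_Icc.2 zero_le_one) zero_le_one
  simp [F] at this
  linarith

/-- One inexact projected gradient step, compared with an arbitrary point `u` of the constraint
set `C`. Here `e` is the error made in the evaluation of the gradient. -/
theorem projected_gradient_step_le {s C : Set X} (hC : Convex ℝ C) (hCs : C ⊆ s)
    {f : X → ℝ} {g : X → X} {L ω : ℝ} (hω : 0 < ω) (hωL : L * ω ≤ 1)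
    (hconv : ConvexOn ℝ s f) (hf : ∀ a ∈ s, HasFDerivAt f (innerSL ℝ (g a)) a)
    (hg : ∀ a ∈ s, ∀ b ∈ s, ‖g a - g b‖ ≤ L * ‖a - b‖)
    {z e p u : X} {η : ℝ} (hz : z ∈ s) (hp : p ∈ C) (hu : u ∈ C)
    (hproj : ∀ v ∈ C, ‖z - ω • (g z + e) - p‖ ≤ ‖z - ω • (g z + e) - v‖)
    (hη : ‖e‖ * ‖u - p‖ ≤ η) :
    2 * ω * f p ≤ 2 * ω * f u + 2 * ⟪z - p, z - u⟫ - ‖z - p‖ ^ 2 + 2 * ω * η := by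
  have hvar : ⟪z - ω • (g z + e) - p, u - p⟫ ≤ 0 := by
    refine (norm_eq_iInf_iff_real_inner_le_zero hC hp).1 ?_ u hu
    have : Nonempty C := ⟨⟨p, hp⟩⟩
    refine le_antisymm (le_ciInf fun w => hproj w w.2) ?_
    exact ciInf_le ⟨0, by rintro _ ⟨w, rfl⟩; exact norm_nonneg _⟩ (⟨p, hp⟩ : C)
  have h1 := hconv.add_fderiv_sub_le hz (hCs hu) (hf z hz)
  have h2 := hconv.1.le_add_inner_add_of_gradient_lipschitz hf hg hz (hCs hp)
  have h3 : ⟪e, u - p⟫ ≤ η := (real_inner_le_norm _ _).trans hη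
  have h4 : ‖z - p‖ ^ 2 = ⟪z - p, z - p⟫ := (real_inner_self_eq_norm_sq _).symm
  rw [norm_sub_rev p z] at h2
  have h5 : L * ω * ‖z - p‖ ^ 2 ≤ ‖z - p‖ ^ 2 := by nlinarith [sq_nonneg ‖z - p‖]
  simp only [innerSL_apply_apply] at h1
  have e1 : ⟪z - ω • (g z + e) - p, u - p⟫
      = ⟪z - p, z - p⟫ - ⟪z - p, z - u⟫ - ω * (⟪g z, u - z⟫ - ⟪g z, p - z⟫ + ⟪e, u - p⟫) := by
    simp only [inner_sub_left, inner_sub_right, inner_add_left, inner_smul_left]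
    simp
    ring
  rw [e1, ← h4] at hvar
  have h6 : ω * (f p - f u) ≤ ω * (⟪g z, p - z⟫ - ⟪g z, u - z⟫ + L / 2 * ‖z - p‖ ^ 2) :=
    mul_le_mul_of_nonneg_left (by linarith) hω.le
  have h7 := mul_le_mul_of_nonneg_left h3 hω.le
  linarith

/-- Decrease of the Nesterov energy in one step. -/
theorem nesterov_energy_step_le {ω η k s c fk fp : ℝ} {x z p xs : X}
    (hk : 0 ≤ k) (hc : 0 ≤ c) (hs : s = k + c)
    (h1 : 2 * ω * fp ≤ 2 * ω * fk + 2 * ⟪z - p, z - x⟫ - ‖z - p‖ ^ 2 + 2 * ω * η)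
    (h2 : 2 * ω * fp ≤ 2 * ⟪z - p, z - xs⟫ - ‖z - p‖ ^ 2 + 2 * ω * η) :
    2 * ω * s ^ 2 * fp + ‖s • p - k • x - c • xs‖ ^ 2
      ≤ 2 * ω * (s * k) * fk + ‖s • z - k • x - c • xs‖ ^ 2 + 2 * ω * s ^ 2 * η := by
  have hv : s • p - k • x - c • xs = (s • z - k • x - c • xs) - s • (z - p) := by
    module
  have hw : s • z - k • x - c • xs = k • (z - x) + c • (z - xs) := by
    rw [hs]; module
  rw [hv, norm_sub_sq_real, hw, norm_smul, inner_smul_right, real_inner_comm, inner_add_right,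
    inner_smul_right, inner_smul_right, mul_pow, Real.norm_eq_abs, sq_abs]
  have h3 := mul_le_mul_of_nonneg_left h1 hk
  have h4 := mul_le_mul_of_nonneg_left h2 hc
  have h5 := mul_le_mul_of_nonneg_left (add_le_add h3 h4) (by rw [hs]; positivity : 0 ≤ s)
  subst hs
  linarith

/-- Along an inexact projected Nesterov iteration, the energy is bounded by its initial value as
long as the functional values dominate the gradient errors. -/
theorem nesterov_energy_le {s C : Set X} (hC : Convex ℝ C) (hCs : C ⊆ s)
    {f : X → ℝ} {g : X → X} {L ω α η : ℝ} (hω : 0 < ω) (hωL : L * ω ≤ 1) (hα : 3 < α)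
    (hconv : ConvexOn ℝ s f) (hf : ∀ a ∈ s, HasFDerivAt f (innerSL ℝ (g a)) a)
    (hg : ∀ a ∈ s, ∀ b ∈ s, ‖g a - g b‖ ≤ L * ‖a - b‖) (hf0 : ∀ a, 0 ≤ f a)
    {x z e : ℕ → X} {xs : X} (hxs : xs ∈ C) (hfxs : f xs = 0)
    (hxC : ∀ k, x k ∈ C) (hzs : ∀ k, z k ∈ s)
    (hz : ∀ k, z k = x k + (((k : ℝ) - 1) / ((k : ℝ) + α - 1)) • (x k - x (k - 1)))
    (hproj : ∀ k, ∀ v ∈ C,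
      ‖z k - ω • (g (z k) + e k) - x (k + 1)‖ ≤ ‖z k - ω • (g (z k) + e k) - v‖)
    (hη : ∀ k, ∀ u ∈ C, ‖e k‖ * ‖u - x (k + 1)‖ ≤ η) {K : ℕ}
    (hdisc : ∀ k : ℕ, 1 ≤ k → k < K →
      ((k : ℝ) + α - 1) ^ 2 * η ≤ (k : ℝ) * (α - 3) * f (x k)) (k : ℕ) (hk : k + 1 ≤ K) :
    2 * ω * ((k : ℝ) + α - 1) ^ 2 * f (x (k + 1))
        + ‖((k : ℝ) + α - 1) • x (k + 1) - (k : ℝ) • x k - (α - 1) • xs‖ ^ 2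
      ≤ 2 * ω * (α - 1) ^ 2 * f (x 1) + (α - 1) ^ 2 * ‖x 1 - xs‖ ^ 2 := by
  induction k with
  | zero =>
    simp only [Nat.cast_zero, zero_add, zero_smul, sub_zero]
    rw [← smul_sub, norm_smul, mul_pow, Real.norm_eq_abs, sq_abs]
  | succ k ih =>
    refine le_trans ?_ (ih (by omega))
    have step : ∀ u ∈ C, _ := fun u hu =>
      projected_gradient_step_le hC hCs hω hωL hconv hf hg (hzs (k + 1)) (hxC (k + 2)) hu
        (hproj (k + 1)) (hη (k + 1) u hu)
    have h2 := step xs hxs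
    rw [hfxs, mul_zero, zero_add] at h2
    have h3 := nesterov_energy_step_le (k := ((k + 1 : ℕ) : ℝ)) (c := α - 1) (by positivity)
      (by linarith) rfl (step _ (hxC (k + 1))) h2
    have hpos : ((k + 1 : ℕ) : ℝ) + (α - 1) ≠ 0 := by
      have : (0 : ℝ) ≤ ((k + 1 : ℕ) : ℝ) := by positivity
      linarith
    have hv : (((k + 1 : ℕ) : ℝ) + (α - 1)) • z (k + 1) - ((k + 1 : ℕ) : ℝ) • x (k + 1)
        - (α - 1) • xs = ((k : ℝ) + α - 1) • x (k + 1) - (k : ℝ) • x k - (α - 1) • xs := by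
      rw [hz (k + 1), add_sub_assoc _ α 1, smul_add, smul_smul, mul_div_cancel₀ _ hpos,
        Nat.add_sub_cancel]
      push_cast
      module
    rw [hv, ← add_sub_assoc] at h3
    refine h3.trans ?_
    have h4 := mul_le_mul_of_nonneg_left (hdisc (k + 1) (by omega) (by omega)) hω.le
    have h5 : 0 ≤ ω * ((α - 2) ^ 2 * f (x (k + 1))) := by
      have := hf0 (x (k + 1))
      positivity
    push_cast at h4 ⊢
    have h6 : ((k : ℝ) + α - 1) ^ 2
        = ((k : ℝ) + 1 + α - 1) * (k + 1) + (k + 1) * (α - 3) + (α - 2) ^ 2 := by ring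
    rw [h6]
    linarith

end Hilbert

section Residual

variable {X Y : Type*} [NormedAddCommGroup X] [InnerProductSpace ℝ X] [CompleteSpace X]
  [NormedAddCommGroup Y] [InnerProductSpace ℝ Y] [CompleteSpace Y]

/-- The gradient of the least squares functional `½‖F u - y‖²`. -/
theorem HasFDerivAt.half_norm_sub_sq {F : X → Y} {A : X →L[ℝ] Y} {a : X}
    (hF : HasFDerivAt F A a) (y : Y) :
    HasFDerivAt (fun u => (1 / 2 : ℝ) * ‖F u - y‖ ^ 2)
      (innerSL ℝ (ContinuousLinearMap.adjoint A (F a - y))) a := by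
  refine ((hF.sub_const y).norm_sq.const_mul (1 / 2 : ℝ)).congr_fderiv ?_
  ext v
  simp [ContinuousLinearMap.adjoint_inner_left]

end Residual

/-- If the residual at an index violates the stopping rule, the functional value
dominates the error terms in the energy estimate. -/
theorem energy_error_le_of_discrepancy {κ s a r r₀ δ Δ η τ : ℝ} (hκ : 0 < κ) (ha : 0 < a)
    (hs : κ * a ≤ s ^ 2) (hη : 0 ≤ η) (hr : r ≤ r₀ + δ) (hr' : 0 ≤ r)
    (hΔ : 4 * η + 3 * δ ^ 2 ≤ Δ)
    (h : ¬ r ^ 2 ≤ 2 * s ^ 2 / (κ * a) * Δ + τ ^ 2 * δ ^ 2) :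
    s ^ 2 * η ≤ κ * a * ((1 / 2) * r₀ ^ 2) := by
  have hκa : 0 < κ * a := mul_pos hκ ha
  set A := s ^ 2 / (κ * a) with hA
  have hA1 : 1 ≤ A := (one_le_div hκa).2 hs
  have hsA : s ^ 2 = κ * a * A := by rw [hA, mul_div_cancel₀ _ hκa.ne']
  rw [mul_div_assoc, ← hA, not_le] at h
  rw [hsA, mul_assoc (κ * a)]
  refine mul_le_mul_of_nonneg_left ?_ hκa.le
  have h1 : r ^ 2 ≤ 2 * r₀ ^ 2 + 2 * δ ^ 2 := by
    nlinarith [sq_nonneg (r₀ - δ), pow_le_pow_left₀ hr' hr 2]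
  have h2 : A * (4 * η + 3 * δ ^ 2) ≤ A * Δ := mul_le_mul_of_nonneg_left hΔ (by linarith)
  have h3 : δ ^ 2 ≤ A * δ ^ 2 := le_mul_of_one_le_left (sq_nonneg δ) hA1
  have h4 : 0 ≤ τ ^ 2 * δ ^ 2 := by positivity
  have h5 : 0 ≤ A * η := mul_nonneg (by linarith) hη
  nlinarith

/-- A sequence tends to zero if it is `O(k⁻²)` and, at the same time, bounded by `k * b + d` with
`b` and `d` tending to zero. -/
theorem tendsto_zero_of_mul_sq_le_of_le_mul_add {a b d : ℕ → ℝ} {k : ℕ → ℕ} {C : ℝ}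
    (ha : ∀ n, 0 ≤ a n) (hb : ∀ n, 0 ≤ b n) (hC : ∀ n, a n * (k n : ℝ) ^ 2 ≤ C)
    (hle : ∀ n, a n ≤ k n * b n + d n) (hb0 : Tendsto b atTop (𝓝 0))
    (hd0 : Tendsto d atTop (𝓝 0)) : Tendsto a atTop (𝓝 0) := by
  refine tendsto_order.2 ⟨fun ε hε => Eventually.of_forall fun n => hε.trans_le (ha n),
    fun ε hε => ?_⟩
  obtain ⟨K, hK⟩ := exists_nat_gt (max 1 (C / ε))
  have hK1 : (1 : ℝ) < K := (le_max_left _ _).trans_lt hK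
  have hKC : C < K * ε := (div_lt_iff₀ hε).1 ((le_max_right _ _).trans_lt hK)
  have hlim : Tendsto (fun n => (K : ℝ) * b n + d n) atTop (𝓝 0) := by
    simpa using (hb0.const_mul (K : ℝ)).add hd0
  filter_upwards [hlim.eventually_lt_const hε] with n hn
  rcases lt_or_ge (k n) K with h | h
  · have : (k n : ℝ) * b n ≤ K * b n :=
      mul_le_mul_of_nonneg_right (by exact_mod_cast h.le) (hb n)
    linarith [hle n]
  · by_contra! hcon
    have h1 : (K : ℝ) ≤ k n := by exact_mod_cast h
    have h2 : (K : ℝ) ≤ (k n : ℝ) ^ 2 := by nlinarith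
    have h3 : ε * K ≤ a n * (k n : ℝ) ^ 2 := mul_le_mul hcon h2 (by linarith) (ha n)
    linarith [hC n]

/-- Regularization property: along any sequence of noise levels `δ_n → 0`
with data `y_n`, the iterates stopped by the rule \eqref{stoprule} have a subsequence
converging weakly to a solution `x̃ ∈ S`; if `S` is a singleton, the whole sequence of
stopped iterates converges weakly. -/
theorem nesterov_regularization_weak_convergence
    {X Y : Type*} [NormedAddCommGroup X] [InnerProductSpace ℝ X] [CompleteSpace X]
    [NormedAddCommGroup Y] [InnerProductSpace ℝ Y] [CompleteSpace Y]
    (x₀ : X) (ρ : ℝ) (hρ : 0 < ρ)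
    (F : X → Y) (F' : X → X →L[ℝ] Y)
    (hF : ∀ u ∈ closedBall x₀ (6 * ρ), HasFDerivAt F (F' u) u)
    (ωb : ℝ) (hωb : ∀ u ∈ closedBall x₀ (6 * ρ), ‖F' u‖ ≤ ωb)
    -- weak sequential closedness of `F` on `B_{2ρ}(x₀)`
    (hwsc : ∀ (u : ℕ → X) (u' : X) (v : Y),
      (∀ n, u n ∈ closedBall x₀ (2 * ρ)) →
      (∀ h : X, Tendsto (fun n => ⟪u n, h⟫) atTop (nhds ⟪u', h⟫)) →
      Tendsto (fun n => F (u n)) atTop (nhds v) →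
      u' ∈ closedBall x₀ (2 * ρ) ∧ F u' = v)
    (y : Y) (xstar : X) (hxstar : xstar ∈ closedBall x₀ ρ) (hFxstar : F xstar = y)
    (Φ0 : X → ℝ)
    (hΦ0 : ∀ u, Φ0 u = (1 / 2) * ‖F u - y‖ ^ 2)
    (hconv : ConvexOn ℝ (closedBall x₀ (6 * ρ)) Φ0)
    (L : ℝ) (hL : 0 < L)
    (hLip : ∀ u ∈ closedBall x₀ (6 * ρ), ∀ v ∈ closedBall x₀ (6 * ρ),
      ‖(ContinuousLinearMap.adjoint (F' u)) (F u - y) -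
        (ContinuousLinearMap.adjoint (F' v)) (F v - y)‖ ≤ L * ‖u - v‖)
    (α ω : ℝ) (hα : 3 < α) (hω : 0 < ω) (hωL : ω < 1 / L)
    (P : X → X)
    (hP_mem : ∀ u, P u ∈ closedBall x₀ (2 * ρ))
    (hP_proj : ∀ u, ∀ v ∈ closedBall x₀ (2 * ρ), ‖u - P u‖ ≤ ‖u - v‖)
    (τ : ℝ) (hτ : 1 < τ)
    (c₁ c₂ : ℝ)
    (hc₁ : c₁ = 2 * ωb ^ 3 * ω * ρ + 20 * ρ * ωb)
    (hc₂ : c₂ = 3 + (1 / 2) * ωb ^ 4 * ω ^ 2 + (1 / 2) * ω * ωb ^ 2)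
    -- a sequence of noise levels `δ_n → 0` and corresponding data `y_n`
    (δn : ℕ → ℝ) (hδn : ∀ n, 0 < δn n) (hδn0 : Tendsto δn atTop (nhds 0))
    (yn : ℕ → Y) (hyn : ∀ n, ‖y - yn n‖ ≤ δn n)
    -- for each `n`, the Nesterov iteration with data `y_n`
    (x z : ℕ → ℕ → X)
    (hx0 : ∀ n, x n 0 = x₀)
    (hz : ∀ n k, z n k = x n k + (((k : ℝ) - 1) / ((k : ℝ) + α - 1)) • (x n k - x n (k - 1)))
    (hx : ∀ n k, x n (k + 1)
      = P (z n k + ω • (ContinuousLinearMap.adjoint (F' (z n k))) (yn n - F (z n k))))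
    -- for each `n`, the stopping index `k*(δ_n, y_n)`
    (ks : ℕ → ℕ)
    (hks1 : ∀ n, 1 ≤ ks n)
    (hks2 : ∀ n, ‖F (x n (ks n)) - yn n‖ ^ 2
      ≤ 2 * ((ks n : ℝ) + α - 1) ^ 2 / ((ks n : ℝ) * (α - 3)) * (c₁ * δn n + c₂ * (δn n) ^ 2)
        + τ ^ 2 * (δn n) ^ 2)
    (hks3 : ∀ n, ∀ k : ℕ, 1 ≤ k → k < ks n →
      ¬ (‖F (x n k) - yn n‖ ^ 2
          ≤ 2 * ((k : ℝ) + α - 1) ^ 2 / ((k : ℝ) * (α - 3)) * (c₁ * δn n + c₂ * (δn n) ^ 2)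
            + τ ^ 2 * (δn n) ^ 2)) :
    (∃ xt ∈ {u : X | u ∈ closedBall x₀ (2 * ρ) ∧ F u = y},
      ∃ φ : ℕ → ℕ, StrictMono φ ∧
        ∀ h : X, Tendsto (fun m => ⟪x (φ m) (ks (φ m)), h⟫) atTop (nhds ⟪xt, h⟫)) ∧
    (∀ xt : X, {u : X | u ∈ closedBall x₀ (2 * ρ) ∧ F u = y} = {xt} →
      ∀ h : X, Tendsto (fun n => ⟪x n (ks n), h⟫) atTop (nhds ⟪xt, h⟫)) := by
  have h4ρ : ∀ u ∈ closedBall x₀ (2 * ρ), ∀ v ∈ closedBall x₀ (2 * ρ), ‖u - v‖ ≤ 4 * ρ := by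
    intro u hu v hv
    rw [mem_closedBall] at hu hv
    rw [← dist_eq_norm]
    linarith [dist_triangle_right u v x₀]
  have hCs : closedBall x₀ (2 * ρ) ⊆ closedBall x₀ (6 * ρ) :=
    closedBall_subset_closedBall (by linarith)
  have hxs : xstar ∈ closedBall x₀ (2 * ρ) := closedBall_subset_closedBall (by linarith) hxstar
  have hx₀s : x₀ ∈ closedBall x₀ (2 * ρ) := mem_closedBall_self (by linarith)
  have hωb0 : 0 ≤ ωb := (norm_nonneg _).trans (hωb x₀ (hCs hx₀s))
  have hLω : L * ω ≤ 1 := by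
    rw [lt_div_iff₀ hL] at hωL
    linarith
  obtain rfl : Φ0 = fun u => (1 / 2) * ‖F u - y‖ ^ 2 := funext hΦ0
  have hxC : ∀ n k, x n k ∈ closedBall x₀ (2 * ρ) := by
    intro n k
    cases k with
    | zero => rw [hx0]; exact hx₀s
    | succ k => rw [hx]; exact hP_mem _
  have hzs : ∀ n k, z n k ∈ closedBall x₀ (6 * ρ) := by
    intro n k
    have h1 : ‖(((k : ℝ) - 1) / ((k : ℝ) + α - 1)) • (x n k - x n (k - 1))‖ ≤ 4 * ρ := by
      rcases Nat.eq_zero_or_pos k with rfl | hk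
      · simp [hρ.le]
      · have hk' : (1 : ℝ) ≤ k := by exact_mod_cast hk
        rw [norm_smul, Real.norm_of_nonneg (div_nonneg (by linarith) (by linarith))]
        have h2 : ((k : ℝ) - 1) / ((k : ℝ) + α - 1) ≤ 1 :=
          div_le_one_of_le₀ (by linarith) (by linarith)
        exact (mul_le_of_le_one_left (norm_nonneg _) h2).trans (h4ρ _ (hxC n k) _ (hxC n _))
    rw [mem_closedBall, dist_eq_norm, hz, add_sub_right_comm]
    have h3 := hxC n k
    rw [mem_closedBall, dist_eq_norm] at h3
    linarith [norm_add_le (x n k - x₀)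
      ((((k : ℝ) - 1) / ((k : ℝ) + α - 1)) • (x n k - x n (k - 1)))]
  have hΔ : ∀ n, 4 * (4 * ρ * ωb * δn n) + 3 * δn n ^ 2 ≤ c₁ * δn n + c₂ * δn n ^ 2 := by
    intro n
    have hδ := (hδn n).le
    have h1 : 0 ≤ 2 * ωb ^ 3 * ω * ρ * δn n + 4 * ρ * ωb * δn n := by positivity
    have h2 : 0 ≤ ((1 / 2) * ωb ^ 4 * ω ^ 2 + (1 / 2) * ω * ωb ^ 2) * δn n ^ 2 := by positivity
    rw [hc₁, hc₂]
    linarith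
  have hy : ∀ n k, ‖F (x n k) - yn n‖ ≤ ‖F (x n k) - y‖ + δn n := fun n k =>
    (norm_sub_le_norm_sub_add_norm_sub _ y _).trans (by linarith [hyn n])
  have hbound : ∀ n, ‖F (x n 1) - y‖ ≤ ωb * (4 * ρ) := by
    intro n
    have h1 := (convex_closedBall x₀ (6 * ρ)).norm_image_sub_le_of_norm_hasFDerivWithin_le
      (fun u hu => (hF u hu).hasFDerivWithinAt) hωb (hCs hxs) (hCs (hxC n 1))
    rw [hFxstar] at h1
    exact h1.trans (mul_le_mul_of_nonneg_left (h4ρ _ (hxC n 1) _ hxs) hωb0)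
  set B : ℝ := 2 * ω * (α - 1) ^ 2 * ((1 / 2) * (ωb * (4 * ρ)) ^ 2) + (α - 1) ^ 2 * (4 * ρ) ^ 2
    with hB
  have henergy : ∀ n, ‖F (x n (ks n)) - y‖ ^ 2 * (ks n : ℝ) ^ 2 ≤ B / ω := by
    intro n
    obtain ⟨m, hm⟩ : ∃ m, ks n = m + 1 := ⟨ks n - 1, by have := hks1 n; omega⟩
    have h1 := nesterov_energy_le (convex_closedBall x₀ (2 * ρ)) hCs hω hLω hα hconv
      (g := fun u => ContinuousLinearMap.adjoint (F' u) (F u - y))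
      (fun u hu => (hF u hu).half_norm_sub_sq y) hLip (fun u => by positivity)
      (x := x n) (z := z n) (e := fun k => ContinuousLinearMap.adjoint (F' (z n k)) (y - yn n))
      (η := 4 * ρ * ωb * δn n) hxs (by simp [hFxstar]) (hxC n) (hzs n) (hz n) ?_ ?_ (K := ks n) ?_
      m hm.ge
    · rw [← hm] at h1
      rw [le_div_iff₀ hω]
      have h2 : 2 * ω * (α - 1) ^ 2 * ((1 / 2) * ‖F (x n 1) - y‖ ^ 2)
          + (α - 1) ^ 2 * ‖x n 1 - xstar‖ ^ 2 ≤ B := by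
        rw [hB]
        gcongr
        · exact hbound n
        · exact h4ρ _ (hxC n 1) _ hxs
      have h3 : (ks n : ℝ) ^ 2 ≤ ((m : ℝ) + α - 1) ^ 2 := by
        rw [hm]
        push_cast
        have : (0 : ℝ) ≤ m := by positivity
        exact pow_le_pow_left₀ (by linarith) (by linarith) 2
      have h4 : ω * ‖F (x n (ks n)) - y‖ ^ 2 * (ks n : ℝ) ^ 2
          ≤ ω * ‖F (x n (ks n)) - y‖ ^ 2 * ((m : ℝ) + α - 1) ^ 2 := by gcongr
      have h5 := sq_nonneg
        ‖((m : ℝ) + α - 1) • x n (ks n) - (m : ℝ) • x n m - (α - 1) • xstar‖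
      linarith
    · intro k v hv
      have h2 : z n k - ω • (ContinuousLinearMap.adjoint (F' (z n k)) (F (z n k) - y)
          + ContinuousLinearMap.adjoint (F' (z n k)) (y - yn n))
          = z n k + ω • (ContinuousLinearMap.adjoint (F' (z n k))) (yn n - F (z n k)) := by
        rw [← map_add, sub_eq_add_neg, ← smul_neg, ← map_neg]
        congr 3
        abel
      simp only [h2, hx n k]
      exact hP_proj _ v hv
    · intro k u hu
      have h2 : ‖ContinuousLinearMap.adjoint (F' (z n k)) (y - yn n)‖ ≤ ωb * δn n := by
        refine (ContinuousLinearMap.le_opNorm _ _).trans ?_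
        rw [LinearIsometryEquiv.norm_map]
        exact mul_le_mul (hωb _ (hzs n k)) (hyn n) (norm_nonneg _) hωb0
      calc _ ≤ (ωb * δn n) * (4 * ρ) := by
            have := (hδn n).le
            exact mul_le_mul h2 (h4ρ _ hu _ (hxC n _)) (norm_nonneg _) (by positivity)
        _ = _ := by ring
    · intro k hk1 hk
      have hk' : (1 : ℝ) ≤ k := by exact_mod_cast hk1
      have hδ := (hδn n).le
      exact energy_error_le_of_discrepancy (by linarith) (by linarith) (by nlinarith)
        (by positivity) (hy n k) (norm_nonneg _) (hΔ n) (hks3 n k hk1 hk)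
  have hΔ0 : Tendsto (fun n => c₁ * δn n + c₂ * δn n ^ 2) atTop (𝓝 0) := by
    simpa using (hδn0.const_mul c₁).add ((hδn0.pow 2).const_mul c₂)
  have hsq : Tendsto (fun n => ‖F (x n (ks n)) - y‖ ^ 2) atTop (𝓝 0) := by
    refine tendsto_zero_of_mul_sq_le_of_le_mul_add
      (b := fun n => 4 * α ^ 2 / (α - 3) * (c₁ * δn n + c₂ * δn n ^ 2))
      (d := fun n => (2 * τ ^ 2 + 2) * δn n ^ 2) (fun n => sq_nonneg _) (fun n => ?_) henergy
      (fun n => ?_) (by simpa using hΔ0.const_mul (4 * α ^ 2 / (α - 3)))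
      (by simpa using (hδn0.pow 2).const_mul (2 * τ ^ 2 + 2))
    · have hδ := (hδn n).le
      have : 0 ≤ c₁ * δn n + c₂ * δn n ^ 2 := le_trans (by positivity) (hΔ n)
      have : 0 < α - 3 := by linarith
      positivity
    · have hδ := (hδn n).le
      have hΔn : 0 ≤ c₁ * δn n + c₂ * δn n ^ 2 := le_trans (by positivity) (hΔ n)
      have hk : (1 : ℝ) ≤ ks n := by exact_mod_cast hks1 n
      have hα3 : 0 < α - 3 := by linarith
      have h1 : 2 * ((ks n : ℝ) + α - 1) ^ 2 / ((ks n : ℝ) * (α - 3))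
          ≤ 2 * α ^ 2 / (α - 3) * ks n := by
        rw [div_le_iff₀ (by positivity)]
        have h2 : ((ks n : ℝ) + α - 1) ^ 2 ≤ (α * ks n) ^ 2 :=
          pow_le_pow_left₀ (by linarith) (by nlinarith) 2
        have h3 : 2 * α ^ 2 / (α - 3) * ks n * (ks n * (α - 3)) = 2 * (α * ks n) ^ 2 := by
          field_simp
        linarith
      have h4 := (hks2 n).trans (add_le_add_left (mul_le_mul_of_nonneg_right h1 hΔn) _)
      have h5 : ‖F (x n (ks n)) - y‖ ≤ ‖F (x n (ks n)) - yn n‖ + δn n :=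
        (norm_sub_le_norm_sub_add_norm_sub _ (yn n) _).trans
          (by rw [norm_sub_rev (yn n)]; linarith [hyn n])
      have h6 := (pow_le_pow_left₀ (norm_nonneg _) h5 2).trans add_sq_le
      have h7 : 4 * α ^ 2 / (α - 3) = 2 * (2 * α ^ 2 / (α - 3)) := by ring
      rw [h7]
      linarith
  have hres : Tendsto (fun n => F (x n (ks n))) atTop (𝓝 y) := by
    rw [tendsto_iff_norm_sub_tendsto_zero]
    have h1 := hsq.sqrt
    simpa [Real.sqrt_sq (norm_nonneg _)] using h1
  have hsub : ∀ ψ : ℕ → ℕ, Tendsto ψ atTop atTop → ∃ xt : X,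
      (xt ∈ closedBall x₀ (2 * ρ) ∧ F xt = y) ∧ ∃ φ : ℕ → ℕ, StrictMono φ ∧
        ∀ h : X, Tendsto (fun m => ⟪x (ψ (φ m)) (ks (ψ (φ m))), h⟫) atTop (𝓝 ⟪xt, h⟫) := by
    intro ψ hψ
    obtain ⟨xt, φ, hφ, hlim⟩ := exists_subseq_tendsto_inner
      (u := fun m => x (ψ m) (ks (ψ m))) (R := ‖x₀‖ + 2 * ρ)
      (fun m => norm_le_of_mem_closedBall (hxC _ _))
    exact ⟨xt, hwsc _ xt y (fun m => hxC _ _) hlim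
      (hres.comp (hψ.comp hφ.tendsto_atTop)), φ, hφ, hlim⟩
  refine ⟨hsub id tendsto_id, fun xt hS h => ?_⟩
  refine tendsto_of_subseq_tendsto fun ψ hψ => ?_
  obtain ⟨x', hx', φ, -, hlim⟩ := hsub ψ hψ
  obtain rfl : x' = xt := by
    have : x' ∈ {u : X | u ∈ closedBall x₀ (2 * ρ) ∧ F u = y} := hx'
    rwa [hS] at this
  exact ⟨φ, hlim h⟩
end
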